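/- arXiv:1911.03023 — 3 statements merged into one kernel-verified Lean document; each statement's English description precedes it below -/
import Mathlib

section
/- For every φ ∈ C_c^∞(ℝ², ℂ), the integral ∫_{ℝ²} (∂_{z̄} φ)(z) / z̄ dx dy converges absolutely, the limit lim_{r → 0⁺} ∫_{|z| ≥ r} φ(z) / z̄² dx dy exists, and these two quantities are equal. (Equivalently, the distributional ∂_{z̄}-derivative of the Cauchy kernel 1/(π z̄) equals −p.v. 1/(π z̄²).) -/
open MeasureTheory Complex Filter
open scoped ENNReal

noncomputable section

/-- The Cauchy operator `∂_z̄ f = (∂_x f + i ∂_y f)/2` (pointwise, via `fderiv`). -/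
def dzbar (f : ℂ → ℂ) (z : ℂ) : ℂ :=
  (fderiv ℝ f z 1 + Complex.I * fderiv ℝ f z Complex.I) / 2

lemma HasCompactSupport.dzbar {f : ℂ → ℂ} (hf : HasCompactSupport f) :
    HasCompactSupport (dzbar f) := by
  refine (hf.fderiv (𝕜 := ℝ)).mono fun z hz => ?_
  contrapose! hz
  simp only [Function.mem_support, not_not] at hz ⊢
  simp [_root_.dzbar, hz]

lemma dzbar_mul {f g : ℂ → ℂ} {z : ℂ} (hf : DifferentiableAt ℝ f z)
    (hg : DifferentiableAt ℝ g z) :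
    dzbar (fun w => f w * g w) z = dzbar f z * g z + f z * dzbar g z := by
  simp only [dzbar, fderiv_fun_mul hf hg, add_apply,
    smul_apply, smul_eq_mul]
  ring

lemma dzbar_eq_zero_of_hasDerivAt {f : ℂ → ℂ} {f' z : ℂ} (hf : HasDerivAt f f' z) :
    dzbar f z = 0 := by
  have h : HasFDerivAt f _ z := hf.hasFDerivAt.restrictScalars ℝ
  rw [dzbar, h.fderiv]
  simp [← mul_assoc]

lemma dzbar_conj_of_hasDerivAt {f : ℂ → ℂ} {f' z : ℂ} (hf : HasDerivAt f f' z) :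
    dzbar (fun w => (starRingEnd ℂ) (f w)) z = (starRingEnd ℂ) f' := by
  have h : HasFDerivAt f _ z := hf.hasFDerivAt.restrictScalars ℝ
  have h2 : HasFDerivAt (fun w => (starRingEnd ℂ) (f w)) _ z :=
    (conjCLE : ℂ →L[ℝ] ℂ).hasFDerivAt.comp z h
  rw [dzbar, h2.fderiv]
  simp [← mul_assoc]

/-- The Cauchy kernel `1/z̄ = z/|z|²`, continued by the holomorphic function `z/r²` inside the
disc of radius `r`. -/
def truncatedCauchyKernel (r : ℝ) (z : ℂ) : ℂ := z / ((max ‖z‖ r : ℝ) : ℂ) ^ 2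

lemma truncatedCauchyKernel_of_le {r : ℝ} {z : ℂ} (h : r ≤ ‖z‖) :
    truncatedCauchyKernel r z = ((starRingEnd ℂ) z)⁻¹ := by
  rw [truncatedCauchyKernel, max_eq_left h]
  rcases eq_or_ne z 0 with rfl | hz
  · simp
  · have hz' : (starRingEnd ℂ) z ≠ 0 := by simpa using hz
    rw [← Complex.mul_conj']
    field_simp

lemma norm_truncatedCauchyKernel {r : ℝ} (hr : 0 < r) (z : ℂ) :
    ‖truncatedCauchyKernel r z‖ = ‖z‖ / max ‖z‖ r ^ 2 := by
  have : 0 < max ‖z‖ r := lt_max_of_lt_right hr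
  rw [truncatedCauchyKernel, norm_div, norm_pow, Complex.norm_real, Real.norm_of_nonneg this.le]

lemma norm_truncatedCauchyKernel_le_inv_max {r : ℝ} (hr : 0 < r) (z : ℂ) :
    ‖truncatedCauchyKernel r z‖ ≤ (max ‖z‖ r)⁻¹ := by
  have : 0 < max ‖z‖ r := lt_max_of_lt_right hr
  rw [norm_truncatedCauchyKernel hr, div_le_iff₀ (by positivity)]
  calc ‖z‖ ≤ max ‖z‖ r := le_max_left _ _
    _ = _ := by field_simp

lemma norm_truncatedCauchyKernel_le_inv_norm {r : ℝ} (hr : 0 < r) (z : ℂ) :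
    ‖truncatedCauchyKernel r z‖ ≤ ‖z‖⁻¹ := by
  rcases eq_or_ne z 0 with rfl | hz
  · simp [truncatedCauchyKernel]
  · have : 0 < ‖z‖ := norm_pos_iff.2 hz
    exact (norm_truncatedCauchyKernel_le_inv_max hr z).trans (by gcongr; exact le_max_left _ _)

lemma norm_truncatedCauchyKernel_le_inv_radius {r : ℝ} (hr : 0 < r) (z : ℂ) :
    ‖truncatedCauchyKernel r z‖ ≤ r⁻¹ :=
  (norm_truncatedCauchyKernel_le_inv_max hr z).trans (by gcongr; exact le_max_right _ _)

lemma lipschitzWith_truncatedCauchyKernel {r : ℝ} (hr : 0 < r) :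
    ∃ K, LipschitzWith K (truncatedCauchyKernel r) := by
  refine ⟨⟨3 / r ^ 2, by positivity⟩, LipschitzWith.of_dist_le_mul fun z w => ?_⟩
  have hw := norm_truncatedCauchyKernel_le_inv_max hr w
  rw [norm_truncatedCauchyKernel hr] at hw
  have hMz : r ≤ max ‖z‖ r := le_max_right _ _
  have hMw : r ≤ max ‖w‖ r := le_max_right _ _
  have hM : |max ‖w‖ r - max ‖z‖ r| ≤ ‖z - w‖ := by
    refine (abs_max_sub_max_le_abs _ _ _).trans ?_
    rw [norm_sub_rev]
    exact abs_norm_sub_norm_le w z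
  simp only [truncatedCauchyKernel]
  generalize max ‖z‖ r = M at *
  generalize max ‖w‖ r = N at *
  have hM0 : 0 < M := hr.trans_le hMz
  have hN0 : 0 < N := hr.trans_le hMw
  have hMc : (M : ℂ) ≠ 0 := by exact_mod_cast hM0.ne'
  have hNc : (N : ℂ) ≠ 0 := by exact_mod_cast hN0.ne'
  have key : z / (M : ℂ) ^ 2 - w / (N : ℂ) ^ 2
      = (z - w) / (M : ℂ) ^ 2 +
        w / (N : ℂ) ^ 2 * ((N - M : ℝ) : ℂ) * ((N + M : ℝ) : ℂ) / (M : ℂ) ^ 2 := by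
    push_cast
    field_simp
    ring
  rw [dist_eq_norm, dist_eq_norm, key]
  have hfirst : ‖(z - w) / (M : ℂ) ^ 2‖ ≤ ‖z - w‖ / r ^ 2 := by
    rw [norm_div, norm_pow, Complex.norm_real, Real.norm_of_nonneg hM0.le]
    gcongr
  have hsecond : ‖w / (N : ℂ) ^ 2 * ((N - M : ℝ) : ℂ) * ((N + M : ℝ) : ℂ) / (M : ℂ) ^ 2‖
      ≤ 2 * ‖z - w‖ / r ^ 2 := by
    simp only [norm_div, norm_mul, norm_pow, Complex.norm_real, Real.norm_eq_abs,
      abs_of_pos hM0, abs_of_pos hN0, abs_of_pos (add_pos hN0 hM0)]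
    calc ‖w‖ / N ^ 2 * |N - M| * (N + M) / M ^ 2
        ≤ N⁻¹ * ‖z - w‖ * (N + M) / M ^ 2 := by gcongr
      _ = ‖z - w‖ * (1 / (M * M) + 1 / (N * M)) := by field_simp
      _ ≤ ‖z - w‖ * (1 / (r * r) + 1 / (r * r)) := by gcongr
      _ = 2 * ‖z - w‖ / r ^ 2 := by field_simp; ring
  calc _ ≤ ‖z - w‖ / r ^ 2 + 2 * ‖z - w‖ / r ^ 2 :=
        (norm_add_le _ _).trans (add_le_add hfirst hsecond)
    _ = 3 / r ^ 2 * ‖z - w‖ := by ring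

lemma differentiableAt_dzbar_truncatedCauchyKernel {r : ℝ} (hr : 0 < r) {z : ℂ} (hz : ‖z‖ ≠ r) :
    DifferentiableAt ℝ (truncatedCauchyKernel r) z ∧ dzbar (truncatedCauchyKernel r) z =
      -({z : ℂ | r ≤ ‖z‖}.indicator (fun z => 1 / ((starRingEnd ℂ) z) ^ 2) z) := by
  rcases hz.lt_or_gt with h | h
  · have heq : truncatedCauchyKernel r =ᶠ[nhds z] fun w => w / (r : ℂ) ^ 2 := by
      filter_upwards [continuous_norm.continuousAt.eventually (Iio_mem_nhds h)] with w hw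
      rw [truncatedCauchyKernel, max_eq_right (le_of_lt hw)]
    have hd : HasDerivAt (fun w : ℂ => w / (r : ℂ) ^ 2) (1 / (r : ℂ) ^ 2) z :=
      (hasDerivAt_id z).div_const _
    refine ⟨(hd.differentiableAt.restrictScalars ℝ).congr_of_eventuallyEq heq, ?_⟩
    rw [Set.indicator_of_notMem (by simpa using h), neg_zero, dzbar, heq.fderiv_eq]
    exact dzbar_eq_zero_of_hasDerivAt hd
  · have heq : truncatedCauchyKernel r =ᶠ[nhds z] fun w => (starRingEnd ℂ) w⁻¹ := by
      filter_upwards [continuous_norm.continuousAt.eventually (Ioi_mem_nhds h)] with w hw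
      rw [truncatedCauchyKernel_of_le (le_of_lt hw), map_inv₀]
    have hd := hasDerivAt_inv (norm_pos_iff.1 (hr.trans h))
    refine ⟨(conjCLE.differentiableAt.comp z
      (hd.differentiableAt.restrictScalars ℝ)).congr_of_eventuallyEq heq, ?_⟩
    rw [Set.indicator_of_mem (show z ∈ {z : ℂ | r ≤ ‖z‖} from h.le), dzbar, heq.fderiv_eq]
    refine (dzbar_conj_of_hasDerivAt hd).trans ?_
    simp

lemma locallyIntegrable_inv_conj :
    LocallyIntegrable (fun z : ℂ => ((starRingEnd ℂ) z)⁻¹) volume := by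
  refine locallyIntegrable_of_norm_le_rpow (C := 1) (α := 1) (by simp) (by simp) ?_ ?_
  · refine Eventually.of_forall fun z => ?_
    simp [Real.rpow_neg_one]
  · exact (Complex.continuous_conj.measurable.inv).aestronglyMeasurable

lemma integrable_fderiv_apply_of_lipschitzWith {E F : Type*}
    [NormedAddCommGroup E] [NormedSpace ℝ E] [FiniteDimensional ℝ E] [MeasurableSpace E]
    [BorelSpace E] [NormedAddCommGroup F] [NormedSpace ℝ F] [FiniteDimensional ℝ F]
    {μ : Measure E} [IsFiniteMeasureOnCompacts μ] {K : NNReal} {g : E → F}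
    (hg : LipschitzWith K g) (hc : HasCompactSupport g) (v : E) :
    Integrable (fun x => fderiv ℝ g x v) μ := by
  borelize F
  have hcs : HasCompactSupport (fun x => fderiv ℝ g x v) := hc.fderiv_apply ℝ v
  rw [← integrableOn_iff_integrable_of_support_subset (subset_tsupport _)]
  refine Measure.integrableOn_of_bounded (M := K * ‖v‖) hcs.measure_lt_top.ne
    (measurable_fderiv_apply_const ℝ g v).aestronglyMeasurable (Eventually.of_forall fun x => ?_)
  exact (fderiv ℝ g x).le_of_opNorm_le (norm_fderiv_le_of_lipschitz ℝ hg) v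

lemma integral_fderiv_apply_eq_zero_of_lipschitzWith {E F : Type*}
    [NormedAddCommGroup E] [NormedSpace ℝ E] [FiniteDimensional ℝ E] [MeasurableSpace E]
    [BorelSpace E] [NormedAddCommGroup F] [NormedSpace ℝ F] [FiniteDimensional ℝ F]
    {μ : Measure E} [μ.IsAddHaarMeasure] {K : NNReal} {g : E → F}
    (hg : LipschitzWith K g) (hc : HasCompactSupport g) (v : E) :
    ∫ x, fderiv ℝ g x v ∂μ = 0 := by
  have : CompleteSpace F := FiniteDimensional.complete ℝ F
  refine SeparatingDual.eq_zero_of_forall_dual_eq_zero (R := ℝ) fun L => ?_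
  have hLg : LipschitzWith (‖L‖₊ * K) (fun x => L (g x)) := L.lipschitz.comp hg
  have hLc : HasCompactSupport (fun x => L (g x)) := hc.comp_left (map_zero L)
  have hparts := (LipschitzWith.const (1 : ℝ)).integral_lineDeriv_mul_eq (μ := μ) hLg hLc (-v)
  rw [← L.integral_comp_comm (integrable_fderiv_apply_of_lipschitzWith hg hc v)]
  rw [show (∫ x, L (fderiv ℝ g x v) ∂μ) = ∫ x, lineDeriv ℝ (fun x => L (g x)) x v ∂μ from ?_]
  · simpa [lineDeriv] using hparts.symm
  · refine integral_congr_ae ?_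
    filter_upwards [hg.ae_differentiableAt (μ := μ)] with x hx
    have hLx : HasFDerivAt (fun x => L (g x)) _ x := L.hasFDerivAt.comp x hx.hasFDerivAt
    rw [hLx.differentiableAt.lineDeriv_eq_fderiv, hLx.fderiv]
    rfl

lemma integrable_dzbar_and_integral_eq_zero {K : NNReal} {g : ℂ → ℂ}
    (hg : LipschitzWith K g) (hc : HasCompactSupport g) :
    Integrable (dzbar g) volume ∧ ∫ z, dzbar g z = 0 := by
  have h1 := integrable_fderiv_apply_of_lipschitzWith (μ := volume) hg hc 1
  have h2 := (integrable_fderiv_apply_of_lipschitzWith (μ := volume) hg hc I).const_mul I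
  refine ⟨(h1.add h2).div_const 2, ?_⟩
  simp only [dzbar]
  rw [integral_div, integral_add h1 h2, integral_const_mul,
    integral_fderiv_apply_eq_zero_of_lipschitzWith hg hc,
    integral_fderiv_apply_eq_zero_of_lipschitzWith hg hc]
  simp

lemma LipschitzWith.exists_mul_of_bounded {X A : Type*} [PseudoMetricSpace X]
    [NonUnitalSeminormedRing A] {f g : X → A} {Kf Kg : NNReal} {a b : ℝ}
    (hf : LipschitzWith Kf f) (hg : LipschitzWith Kg g) (ha : ∀ x, ‖f x‖ ≤ a)
    (hb : ∀ x, ‖g x‖ ≤ b) : ∃ K, LipschitzWith K (fun x => f x * g x) := by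
  refine ⟨(Kf * b + a * Kg).toNNReal, LipschitzWith.of_dist_le' fun x y => ?_⟩
  have ha0 : 0 ≤ a := (norm_nonneg _).trans (ha x)
  rw [dist_eq_norm, show f x * g x - f y * g y = (f x - f y) * g x + f y * (g x - g y) by
    noncomm_ring]
  calc ‖(f x - f y) * g x + f y * (g x - g y)‖
      ≤ ‖f x - f y‖ * ‖g x‖ + ‖f y‖ * ‖g x - g y‖ :=
        (norm_add_le _ _).trans (add_le_add (norm_mul_le _ _) (norm_mul_le _ _))
    _ ≤ (Kf * dist x y) * b + a * (Kg * dist x y) := by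
        gcongr
        · rw [← dist_eq_norm]; exact hf.dist_le_mul x y
        · exact hb x
        · exact ha y
        · rw [← dist_eq_norm]; exact hg.dist_le_mul x y
    _ = (Kf * b + a * Kg) * dist x y := by ring

lemma integral_dzbar_mul_truncatedCauchyKernel {r : ℝ} (hr : 0 < r) {φ : ℂ → ℂ}
    (hφ : ContDiff ℝ 1 φ) (hc : HasCompactSupport φ) :
    ∫ z, dzbar φ z * truncatedCauchyKernel r z =
      ∫ z in {z : ℂ | r ≤ ‖z‖}, φ z / ((starRingEnd ℂ) z) ^ 2 := by
  obtain ⟨Kφ, hKφ⟩ := hφ.lipschitzWith_of_hasCompactSupport hc one_ne_zero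
  obtain ⟨Kk, hKk⟩ := lipschitzWith_truncatedCauchyKernel hr
  obtain ⟨B, hB⟩ := hφ.continuous.bounded_above_of_compact_support hc
  obtain ⟨K, hK⟩ := hKφ.exists_mul_of_bounded hKk hB (norm_truncatedCauchyKernel_le_inv_radius hr)
  obtain ⟨hint, hzero⟩ := integrable_dzbar_and_integral_eq_zero hK hc.mul_right
  have hdz : Continuous (dzbar φ) := by
    have h := hφ.continuous_fderiv one_ne_zero
    unfold dzbar
    fun_prop
  have hint' : Integrable (fun z => dzbar φ z * truncatedCauchyKernel r z) :=
    (hdz.mul hKk.continuous).integrable_of_hasCompactSupport hc.dzbar.mul_right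
  have hmeas : MeasurableSet {z : ℂ | r ≤ ‖z‖} :=
    measurableSet_le measurable_const measurable_norm
  have hsphere : ∀ᵐ z : ℂ, ‖z‖ ≠ r := by
    have h := Measure.addHaar_sphere (volume : Measure ℂ) 0 r
    simpa [ae_iff, Metric.sphere] using h
  rw [← integral_indicator hmeas, ← sub_zero (∫ z, dzbar φ z * truncatedCauchyKernel r z),
    ← hzero, ← integral_sub hint' hint]
  refine integral_congr_ae ?_
  filter_upwards [hsphere] with z hz
  obtain ⟨hd, hk⟩ := differentiableAt_dzbar_truncatedCauchyKernel hr hz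
  rw [dzbar_mul (hφ.differentiable one_ne_zero z) hd, hk]
  by_cases h : r ≤ ‖z‖
  · rw [Set.indicator_of_mem (by exact h), Set.indicator_of_mem (by exact h)]
    ring
  · rw [Set.indicator_of_notMem (by exact h), Set.indicator_of_notMem (by exact h)]
    ring

/-- For every smooth compactly supported `φ : ℂ → ℂ`, the integral
`∫ (∂_z̄ φ)(z)/z̄` converges absolutely, the principal value
`lim_{r → 0⁺} ∫_{|z| ≥ r} φ(z)/z̄²` exists, and the two quantities agree; i.e. the
distributional `∂_z̄`-derivative of the Cauchy kernel `1/(π z̄)` is `-p.v. 1/(π z̄²)`. -/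
theorem dzbar_cauchy_kernel (φ : ℂ → ℂ) (hφ : ContDiff ℝ (⊤ : ℕ∞) φ) (hc : HasCompactSupport φ) :
    Integrable (fun z : ℂ => dzbar φ z / (starRingEnd ℂ) z) volume ∧
    Tendsto (fun r : ℝ => ∫ z in {z : ℂ | r ≤ ‖z‖}, φ z / ((starRingEnd ℂ) z) ^ 2)
      (nhdsWithin 0 (Set.Ioi 0))
      (nhds (∫ z : ℂ, dzbar φ z / (starRingEnd ℂ) z)) := by
  have hdz : Continuous (dzbar φ) := by
    have h := hφ.continuous_fderiv (by simp)
    unfold dzbar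
    fun_prop
  have hdc : HasCompactSupport (dzbar φ) := hc.dzbar
  have hint : Integrable (fun z : ℂ => dzbar φ z / (starRingEnd ℂ) z) volume := by
    simpa [div_eq_mul_inv] using
      locallyIntegrable_inv_conj.integrable_smul_left_of_hasCompactSupport hdz hdc
  refine ⟨hint, ?_⟩
  have hmain : Tendsto (fun r : ℝ => ∫ z, dzbar φ z * truncatedCauchyKernel r z)
      (nhdsWithin 0 (Set.Ioi 0)) (nhds (∫ z : ℂ, dzbar φ z / (starRingEnd ℂ) z)) := by
    refine tendsto_integral_filter_of_dominated_convergence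
      (fun z => ‖dzbar φ z / (starRingEnd ℂ) z‖) ?_ ?_ hint.norm ?_
    · filter_upwards [self_mem_nhdsWithin] with r hr
      obtain ⟨K, hK⟩ := lipschitzWith_truncatedCauchyKernel hr
      exact (hdz.mul hK.continuous).aestronglyMeasurable
    · filter_upwards [self_mem_nhdsWithin] with r hr
      refine Eventually.of_forall fun z => ?_
      rw [norm_mul, norm_div, div_eq_mul_inv, RCLike.norm_conj]
      gcongr
      exact norm_truncatedCauchyKernel_le_inv_norm hr z
    · have h0 : ∀ᵐ z : ℂ, z ≠ 0 := by simp [ae_iff]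
      filter_upwards [h0] with z hz
      refine tendsto_const_nhds.congr' ?_
      have hpos : 0 < ‖z‖ := norm_pos_iff.2 hz
      filter_upwards [mem_nhdsWithin_of_mem_nhds (Iio_mem_nhds hpos)] with r hr
      rw [truncatedCauchyKernel_of_le (le_of_lt hr), div_eq_mul_inv]
  refine hmain.congr' ?_
  filter_upwards [self_mem_nhdsWithin] with r hr
  exact integral_dzbar_mul_truncatedCauchyKernel hr (hφ.of_le (by simp)) hc

end
end

section
/- Let u : ℂ → ℂ be a C¹ function which is divergence free, i.e. ∂_z u + conj(∂_z u) = 0 everywhere (equivalently Re(∂_z u) = 0). Suppose there exist c ∈ ℂ and C > 0 such that |u(z) − c| ≤ C ⟨z⟩^{−1}, |∂_z u(z)| ≤ C ⟨z⟩^{−2} and |∂_{z̄} u(z)| ≤ C ⟨z⟩^{−2} for all z ∈ ℂ. Set Q(u) = (∂_z u)² + |∂_{z̄} u|². Then Q(u) and z̄ · Q(u) are integrable on ℝ², and ∫_{ℝ²} Q(u) dx dy = 0 and ∫_{ℝ²} z̄ Q(u) dx dy = 0. -/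
open MeasureTheory Complex Filter
open scoped ENNReal

noncomputable section

/-- The Japanese bracket `⟨z⟩ = (1 + |z|²)^(1/2)`. -/
def jb (z : ℂ) : ℝ := Real.sqrt (1 + ‖z‖ ^ 2)

/-- The Cauchy operator `∂_z f = (∂_x f - i ∂_y f)/2` (pointwise, via `fderiv`). -/
def dz (f : ℂ → ℂ) (z : ℂ) : ℂ :=
  (fderiv ℝ f z 1 - Complex.I * fderiv ℝ f z Complex.I) / 2

open scoped Topology

/-- For `C¹` functions of compact support, the order of two partial derivatives may be exchanged
across an `L²` pairing; no second derivatives are required. -/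
lemma integral_fderiv_mul_fderiv_comm_of_compact {f g : ℂ → ℝ} (hf : ContDiff ℝ 1 f)
    (hg : ContDiff ℝ 1 g) (hfc : HasCompactSupport f) (hgc : HasCompactSupport g) (v w : ℂ) :
    ∫ z, fderiv ℝ f z v * fderiv ℝ g z w = ∫ z, fderiv ℝ f z w * fderiv ℝ g z v := by
  set h : ℂ → ℝ := fun z => g (-z) with hh
  have hhd : ContDiff ℝ 1 h := hg.comp contDiff_neg
  have hhc : HasCompactSupport h := hgc.comp_homeomorph (Homeomorph.neg ℂ)
  have hfderiv : ∀ z, fderiv ℝ h (-z) = -fderiv ℝ g z := by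
    intro z
    simpa [hh] using fderiv_comp_smul (𝕜 := ℝ) (f := g) (x := -z) (-1)
  have hDf : Continuous (fderiv ℝ f) := hf.continuous_fderiv one_ne_zero
  have hDfc : HasCompactSupport (fderiv ℝ f) := hfc.fderiv ℝ
  have hDh : Continuous (fderiv ℝ h) := hhd.continuous_fderiv one_ne_zero
  have hDhc : HasCompactSupport (fderiv ℝ h) := hhc.fderiv ℝ
  let L : ℝ →L[ℝ] ℝ →L[ℝ] ℝ := ContinuousLinearMap.mul ℝ ℝ
  have h1 := fun y => hfc.hasFDerivAt_convolution_left (μ := volume) L hf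
    hhd.continuous.locallyIntegrable y
  have h2 := hhc.hasFDerivAt_convolution_right (μ := volume) (L.precompL ℂ)
    hDf.locallyIntegrable hhd 0
  have key : ∀ a b : ℂ, (convolution (𝕜 := ℝ) (F := ℂ →L[ℝ] ℂ →L[ℝ] ℝ) (fderiv ℝ f) (fderiv ℝ h)
      (ContinuousLinearMap.precompR ℂ (L.precompL ℂ)) volume 0) a b
      = -∫ z, fderiv ℝ f z b * fderiv ℝ g z a := by
    intro a b
    have hint := hDhc.convolutionExists_right (𝕜 := ℝ) (F := ℂ →L[ℝ] ℂ →L[ℝ] ℝ) (μ := volume)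
      (ContinuousLinearMap.precompR ℂ (L.precompL ℂ)) hDf.locallyIntegrable hDh 0
    have hint' := hint.apply_continuousLinearMap a
    rw [convolution, ContinuousLinearMap.integral_apply hint,
      ContinuousLinearMap.integral_apply hint', ← integral_neg]
    refine integral_congr_ae (.of_forall fun z => ?_)
    simp [ContinuousLinearMap.precompR_apply, ContinuousLinearMap.precompL_apply, hfderiv, L]
  have := second_derivative_symmetric h1 h2 w v
  rw [key, key] at this
  exact neg_injective this

/-- Only one of the two functions needs compact support. -/
lemma integral_fderiv_mul_fderiv_comm {f g : ℂ → ℝ} (hf : ContDiff ℝ 1 f)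
    (hg : ContDiff ℝ 1 g) (hfc : HasCompactSupport f) (v w : ℂ) :
    ∫ z, fderiv ℝ f z v * fderiv ℝ g z w = ∫ z, fderiv ℝ f z w * fderiv ℝ g z v := by
  obtain ⟨r, hr0, hr⟩ := hfc.isCompact.isBounded.subset_ball_lt 0 (0 : ℂ)
  let χ : ContDiffBump (0 : ℂ) := ⟨r, r + 1, hr0, by linarith⟩
  have hloc : ∀ z (a b : ℂ), fderiv ℝ f z a * fderiv ℝ (fun y => χ y * g y) z b
      = fderiv ℝ f z a * fderiv ℝ g z b := by
    intro z a b
    by_cases hz : z ∈ tsupport f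
    · have : (fun y => χ y * g y) =ᶠ[𝓝 z] g := by
        filter_upwards [Metric.isOpen_ball.mem_nhds (hr hz)] with y hy
        rw [χ.one_of_mem_closedBall (Metric.ball_subset_closedBall hy), one_mul]
      rw [this.fderiv_eq]
    · rw [image_eq_zero_of_notMem_tsupport (fun h => hz (tsupport_fderiv_subset ℝ h))]
      simp
  have := integral_fderiv_mul_fderiv_comm_of_compact hf (χ.contDiff.mul hg) hfc
    (χ.hasCompactSupport.mul_right (f' := g)) v w
  simpa only [hloc] using this

/-- The Jacobian determinant of `(f, g)`. -/
def jac (f g : ℂ → ℝ) (z : ℂ) : ℝ :=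
  fderiv ℝ f z 1 * fderiv ℝ g z I - fderiv ℝ f z I * fderiv ℝ g z 1

lemma jac_mul_left {p f g : ℂ → ℝ} {z : ℂ} (hp : DifferentiableAt ℝ p z)
    (hf : DifferentiableAt ℝ f z) :
    jac (fun y => p y * f y) g z = p z * jac f g z + f z * jac p g z := by
  simp only [jac, fderiv_fun_mul hp hf, add_apply, FunLike.coe_smul, Pi.smul_apply, smul_eq_mul]
  ring

lemma continuous_jac {f g : ℂ → ℝ} (hf : ContDiff ℝ 1 f) (hg : ContDiff ℝ 1 g) :
    Continuous (jac f g) := by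
  have h1 := hf.continuous_fderiv one_ne_zero
  have h2 := hg.continuous_fderiv one_ne_zero
  unfold jac
  fun_prop

lemma abs_jac_le (f g : ℂ → ℝ) (z : ℂ) :
    |jac f g z| ≤ 2 * (‖fderiv ℝ f z‖ * ‖fderiv ℝ g z‖) := by
  have h : ∀ (F : ℂ →L[ℝ] ℝ), |F 1| ≤ ‖F‖ ∧ |F I| ≤ ‖F‖ := fun F =>
    ⟨by simpa using F.le_opNorm 1, by simpa using F.le_opNorm I⟩
  obtain ⟨hf1, hf2⟩ := h (fderiv ℝ f z)
  obtain ⟨hg1, hg2⟩ := h (fderiv ℝ g z)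
  calc |jac f g z| ≤ |fderiv ℝ f z 1 * fderiv ℝ g z I| + |fderiv ℝ f z I * fderiv ℝ g z 1| :=
        abs_sub _ _
    _ ≤ ‖fderiv ℝ f z‖ * ‖fderiv ℝ g z‖ + ‖fderiv ℝ f z‖ * ‖fderiv ℝ g z‖ := by
        rw [abs_mul, abs_mul]; gcongr
    _ = _ := by ring

lemma integral_jac_eq_zero {f g : ℂ → ℝ} (hf : ContDiff ℝ 1 f) (hg : ContDiff ℝ 1 g)
    (hfc : HasCompactSupport f) : ∫ z, jac f g z = 0 := by
  have h1 := hf.continuous_fderiv one_ne_zero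
  have h2 := hg.continuous_fderiv one_ne_zero
  have hi : ∀ a b : ℂ, Integrable fun z => fderiv ℝ f z a * fderiv ℝ g z b := fun a b =>
    Continuous.integrable_of_hasCompactSupport (by fun_prop)
      ((hfc.fderiv_apply (𝕜 := ℝ) a).mul_right)
  unfold jac
  rw [integral_sub (hi _ _) (hi _ _), integral_fderiv_mul_fderiv_comm hf hg hfc 1 I, sub_self]

lemma jb_pos (z : ℂ) : 0 < jb z := Real.sqrt_pos.2 (by positivity)

lemma one_le_jb (z : ℂ) : 1 ≤ jb z := Real.one_le_sqrt.2 (by nlinarith [sq_nonneg ‖z‖])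

lemma norm_le_jb (z : ℂ) : ‖z‖ ≤ jb z := Real.le_sqrt_of_sq_le (by linarith)

lemma jb_le_one_add_norm (z : ℂ) : jb z ≤ 1 + ‖z‖ :=
  Real.sqrt_le_iff.2 ⟨by positivity, by nlinarith [norm_nonneg z]⟩

lemma integrable_jb_pow_neg_three : Integrable fun z : ℂ => 1 / jb z ^ 3 := by
  have h := integrable_rpow_neg_one_add_norm_sq (E := ℂ) (μ := volume) (r := 3)
    (by rw [Complex.finrank_real_complex]; norm_num)
  refine h.congr (.of_forall fun z => ?_)
  have h0 : (0 : ℝ) ≤ 1 + ‖z‖ ^ 2 := by positivity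
  simp only [jb, Real.sqrt_eq_rpow, one_div]
  rw [← Real.rpow_natCast (_ ^ _) 3, ← Real.rpow_mul h0, ← Real.rpow_neg h0]
  norm_num

lemma integrable_of_le_jb {E : Type*} [NormedAddCommGroup E] {F : ℂ → E} (hF : Continuous F)
    {K : ℝ} (h : ∀ z, ‖F z‖ ≤ K / jb z ^ 3) : Integrable F := by
  refine (integrable_jb_pow_neg_three.const_mul K).mono' hF.aestronglyMeasurable
    (.of_forall fun z => (h z).trans_eq ?_)
  ring

/-- A `C¹` bump function on the plane. -/
lemma exists_bump : ∃ φ : ℂ → ℝ, ContDiff ℝ 1 φ ∧ HasCompactSupport φ ∧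
    (∀ z, |φ z| ≤ 1) ∧ φ 0 = 1 := by
  let ψ : ContDiffBump (0 : ℂ) := ⟨1, 2, one_pos, one_lt_two⟩
  exact ⟨ψ, ψ.contDiff, ψ.hasCompactSupport,
    fun z => by rw [abs_of_nonneg ψ.nonneg]; exact ψ.le_one,
    ψ.one_of_mem_closedBall (Metric.mem_closedBall_self ψ.rIn_pos.le)⟩

/-- Smooth cutoffs exhausting the plane, with gradients `O(⟨z⟩⁻¹)` uniformly. -/
lemma exists_cutoff : ∃ (χ : ℕ → ℂ → ℝ) (M : ℝ), 0 ≤ M ∧ (∀ n, ContDiff ℝ 1 (χ n)) ∧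
    (∀ n, HasCompactSupport (χ n)) ∧ (∀ n z, |χ n z| ≤ 1) ∧
    (∀ z, Tendsto (fun n => χ n z) atTop (𝓝 1)) ∧
    (∀ n z, ‖fderiv ℝ (χ n) z‖ ≤ M / jb z) ∧
    (∀ z, Tendsto (fun n => fderiv ℝ (χ n) z) atTop (𝓝 0)) := by
  obtain ⟨φ, hφ, hφc, hφ1, hφ0⟩ := exists_bump
  have hD : Continuous (fderiv ℝ φ) := hφ.continuous_fderiv one_ne_zero
  have hDc : HasCompactSupport (fderiv ℝ φ) := hφc.fderiv ℝ
  obtain ⟨M₁, hM₁⟩ := hDc.exists_bound_of_continuous hD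
  have hDc' : HasCompactSupport fun w => ‖w‖ * ‖fderiv ℝ φ w‖ := hDc.norm.mul_left
  obtain ⟨M₂, hM₂⟩ := hDc'.exists_bound_of_continuous (by fun_prop)
  obtain ⟨s, hs, hs0, hs1⟩ : ∃ s : ℕ → ℝ, Tendsto s atTop (𝓝 0) ∧ (∀ n, 0 < s n) ∧
      ∀ n, s n ≤ 1 := by
    refine ⟨fun n => 1 / ((n : ℝ) + 1), tendsto_one_div_add_atTop_nhds_zero_nat,
      fun n => by positivity, fun n => ?_⟩
    rw [div_le_one (by positivity)]
    linarith [(Nat.cast_nonneg n : (0 : ℝ) ≤ n)]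
  have hsz : ∀ z : ℂ, Tendsto (fun n => s n • z) atTop (𝓝 0) := fun z => by
    simpa using hs.smul_const z
  have hfd : ∀ n z, fderiv ℝ (fun y => φ (s n • y)) z = s n • fderiv ℝ φ (s n • z) := fun n z =>
    fderiv_comp_smul (f := φ) (s n)
  refine ⟨fun n z => φ (s n • z), M₁ + M₂,
    add_nonneg ((norm_nonneg _).trans (hM₁ 0)) ((norm_nonneg _).trans (hM₂ 0)),
    fun n => hφ.comp (contDiff_const_smul _), fun n => ?_, fun n z => ?_, fun z => ?_,
    fun n z => ?_, fun z => ?_⟩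
  · exact hφc.comp_smul (hs0 n).ne'
  · exact hφ1 _
  · rw [← hφ0]
    exact (hφ.continuous.tendsto (0 : ℂ)).comp (hsz z)
  · rw [hfd, le_div_iff₀ (jb_pos z), norm_smul, Real.norm_of_nonneg (hs0 n).le]
    have h1 := hM₁ (s n • z)
    have h2 := hM₂ (s n • z)
    rw [norm_mul, norm_norm, norm_norm, norm_smul, Real.norm_of_nonneg (hs0 n).le] at h2
    calc s n * ‖fderiv ℝ φ (s n • z)‖ * jb z
        ≤ s n * ‖fderiv ℝ φ (s n • z)‖ * (1 + ‖z‖) := by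
          gcongr
          · exact mul_nonneg (hs0 n).le (norm_nonneg _)
          · exact jb_le_one_add_norm z
      _ = s n * ‖fderiv ℝ φ (s n • z)‖ + s n * ‖z‖ * ‖fderiv ℝ φ (s n • z)‖ := by ring
      _ ≤ 1 * ‖fderiv ℝ φ (s n • z)‖ + s n * ‖z‖ * ‖fderiv ℝ φ (s n • z)‖ := by
          gcongr; exact hs1 n
      _ ≤ M₁ + M₂ := by rw [one_mul]; exact add_le_add h1 h2
  · simp only [hfd]
    have h := hs.smul ((hD.tendsto (0 : ℂ)).comp (hsz z))
    simpa using h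

/-- If `F = O(⟨z⟩⁻²)` and `DF = O(⟨z⟩⁻³)`, then every directional derivative of `F` has
vanishing integral. -/
lemma integral_fderiv_eq_zero_of_decay {F : ℂ → ℝ} (hF : ContDiff ℝ 1 F) {K : ℝ}
    (h0 : ∀ z, |F z| ≤ K / jb z ^ 2) (h1 : ∀ z, ‖fderiv ℝ F z‖ ≤ K / jb z ^ 3) (v : ℂ) :
    ∫ z, fderiv ℝ F z v = 0 := by
  obtain ⟨χ, M, hM, hχ, hχc, hχ1, hχlim, hDχ, hDχlim⟩ := exists_cutoff
  have hDF := hF.continuous_fderiv one_ne_zero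
  have hcont := fun n => (hχ n).continuous
  have hDcont := fun n => (hχ n).continuous_fderiv one_ne_zero
  have hK : 0 ≤ K := by
    have := (abs_nonneg _).trans (h0 0)
    simpa [jb] using this
  have hparts : ∀ n, ∫ z, χ n z * fderiv ℝ F z v = -∫ z, fderiv ℝ (χ n) z v * F z := by
    intro n
    have := hcont n
    have := hDcont n
    have := hF.continuous
    refine integral_mul_fderiv_eq_neg_fderiv_mul_of_integrable ?_ ?_ ?_
      (fun z _ => (hχ n).differentiable one_ne_zero z)
      (fun z _ => hF.differentiable one_ne_zero z)
    · exact Continuous.integrable_of_hasCompactSupport (by fun_prop)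
        (((hχc n).fderiv_apply (𝕜 := ℝ) v).mul_right)
    · exact Continuous.integrable_of_hasCompactSupport (by fun_prop) (hχc n).mul_right
    · exact Continuous.integrable_of_hasCompactSupport (by fun_prop) (hχc n).mul_right
  have hl : Tendsto (fun n => ∫ z, χ n z * fderiv ℝ F z v) atTop
      (𝓝 (∫ z, fderiv ℝ F z v)) := by
    refine tendsto_integral_of_dominated_convergence (fun z => K * ‖v‖ * (1 / jb z ^ 3))
      (fun n => ?_) (integrable_jb_pow_neg_three.const_mul _) (fun n => .of_forall fun z => ?_)
      (.of_forall fun z => ?_)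
    · have := hcont n
      exact Continuous.aestronglyMeasurable (by fun_prop)
    · rw [norm_mul]
      calc ‖χ n z‖ * ‖fderiv ℝ F z v‖ ≤ 1 * (K / jb z ^ 3 * ‖v‖) := by
            gcongr
            · exact hχ1 n z
            · exact (fderiv ℝ F z).le_of_opNorm_le (h1 z) v
        _ = _ := by ring
    · simpa using (hχlim z).mul_const (fderiv ℝ F z v)
  have hr : Tendsto (fun n => ∫ z, fderiv ℝ (χ n) z v * F z) atTop
      (𝓝 (∫ _ : ℂ, (0 : ℝ))) := by
    refine tendsto_integral_of_dominated_convergence (fun z => M * K * ‖v‖ * (1 / jb z ^ 3))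
      (fun n => ?_) (integrable_jb_pow_neg_three.const_mul _) (fun n => .of_forall fun z => ?_)
      (.of_forall fun z => ?_)
    · have := hDcont n
      have := hF.continuous
      exact Continuous.aestronglyMeasurable (by fun_prop)
    · have hj := jb_pos z
      rw [norm_mul]
      calc ‖fderiv ℝ (χ n) z v‖ * ‖F z‖ ≤ (M / jb z * ‖v‖) * (K / jb z ^ 2) := by
            gcongr
            · exact (fderiv ℝ (χ n) z).le_of_opNorm_le (hDχ n z) v
            · exact h0 z
        _ = _ := by field_simp
    · have h := ((ContinuousLinearMap.apply ℝ ℝ v).continuous.tendsto _).comp (hDχlim z)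
      simpa using h.mul_const (F z)
  simp only [hparts] at hl
  have := tendsto_nhds_unique hl hr.neg
  simpa using this

/-- Integration by parts for the Jacobian determinant against a weight of at most linear growth. -/
lemma integral_mul_jac {p f g : ℂ → ℝ} (hp : ContDiff ℝ 1 p) (hf : ContDiff ℝ 1 f)
    (hg : ContDiff ℝ 1 g) {K : ℝ} (hp0 : ∀ z, |p z| ≤ jb z) (hp1 : ∀ z, ‖fderiv ℝ p z‖ ≤ 1)
    (hf0 : ∀ z, |f z| ≤ K / jb z) (hf1 : ∀ z, ‖fderiv ℝ f z‖ ≤ K / jb z ^ 2)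
    (hg1 : ∀ z, ‖fderiv ℝ g z‖ ≤ K / jb z ^ 2) :
    ∫ z, p z * jac f g z = -∫ z, f z * jac p g z := by
  obtain ⟨χ, M, hM, hχ, hχc, hχ1, hχlim, hDχ, hDχlim⟩ := exists_cutoff
  have hcont := fun n => (hχ n).continuous
  have hcp := hp.continuous
  have hcf := hf.continuous
  have hK : 0 ≤ K := by
    have := (abs_nonneg _).trans (hf0 0)
    simpa [jb] using this
  have cfg := continuous_jac hf hg
  have cpg := continuous_jac hp hg
  have cχg := fun n => continuous_jac (hχ n) hg
  have hA : Tendsto (fun n => ∫ z, χ n z * (p z * jac f g z)) atTop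
      (𝓝 (∫ z, p z * jac f g z)) := by
    refine tendsto_integral_of_dominated_convergence (fun z => 2 * K ^ 2 * (1 / jb z ^ 3))
      (fun n => ?_) (integrable_jb_pow_neg_three.const_mul _) (fun n => .of_forall fun z => ?_)
      (.of_forall fun z => ?_)
    · have := hcont n
      exact Continuous.aestronglyMeasurable (by fun_prop)
    · have hj := jb_pos z
      rw [norm_mul, norm_mul]
      calc ‖χ n z‖ * (‖p z‖ * ‖jac f g z‖)
          ≤ 1 * (jb z * (2 * ((K / jb z ^ 2) * (K / jb z ^ 2)))) := by
            gcongr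
            · exact hχ1 n z
            · exact hp0 z
            · refine (abs_jac_le f g z).trans ?_
              gcongr
              · exact hf1 z
              · exact hg1 z
        _ = _ := by field_simp
    · simpa using (hχlim z).mul_const (p z * jac f g z)
  have hB : Tendsto (fun n => ∫ z, χ n z * (f z * jac p g z)) atTop
      (𝓝 (∫ z, f z * jac p g z)) := by
    refine tendsto_integral_of_dominated_convergence (fun z => 2 * K ^ 2 * (1 / jb z ^ 3))
      (fun n => ?_) (integrable_jb_pow_neg_three.const_mul _) (fun n => .of_forall fun z => ?_)
      (.of_forall fun z => ?_)
    · have := hcont n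
      exact Continuous.aestronglyMeasurable (by fun_prop)
    · have hj := jb_pos z
      rw [norm_mul, norm_mul]
      calc ‖χ n z‖ * (‖f z‖ * ‖jac p g z‖)
          ≤ 1 * (K / jb z * (2 * (1 * (K / jb z ^ 2)))) := by
            gcongr
            · exact hχ1 n z
            · exact hf0 z
            · refine (abs_jac_le p g z).trans ?_
              gcongr
              · exact hp1 z
              · exact hg1 z
        _ = _ := by field_simp
    · simpa using (hχlim z).mul_const (f z * jac p g z)
  have hC : Tendsto (fun n => ∫ z, p z * f z * jac (χ n) g z) atTop (𝓝 (∫ _ : ℂ, (0 : ℝ))) := by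
    refine tendsto_integral_of_dominated_convergence (fun z => 2 * M * K ^ 2 * (1 / jb z ^ 3))
      (fun n => ?_) (integrable_jb_pow_neg_three.const_mul _) (fun n => .of_forall fun z => ?_)
      (.of_forall fun z => ?_)
    · have := cχg n
      exact Continuous.aestronglyMeasurable (by fun_prop)
    · have hj := jb_pos z
      rw [norm_mul, norm_mul]
      calc ‖p z‖ * ‖f z‖ * ‖jac (χ n) g z‖
          ≤ jb z * (K / jb z) * (2 * (M / jb z * (K / jb z ^ 2))) := by
            gcongr
            · exact hp0 z
            · exact hf0 z
            · refine (abs_jac_le (χ n) g z).trans ?_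
              gcongr
              · exact hDχ n z
              · exact hg1 z
        _ = _ := by field_simp
    · have hv : ∀ v : ℂ, Tendsto (fun n => fderiv ℝ (χ n) z v) atTop (𝓝 0) := fun v => by
        simpa [Function.comp_def] using
          ((ContinuousLinearMap.apply ℝ ℝ v).continuous.tendsto _).comp (hDχlim z)
      have := ((hv 1).mul_const (fderiv ℝ g z I)).sub ((hv I).mul_const (fderiv ℝ g z 1))
      simpa [jac] using this.const_mul (p z * f z)
  have hzero : ∀ n, ∫ z, χ n z * (p z * jac f g z) =
      -(∫ z, χ n z * (f z * jac p g z)) - ∫ z, p z * f z * jac (χ n) g z := by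
    intro n
    have c1 := hcont n
    have c2 := cχg n
    have hsupp : HasCompactSupport (jac (χ n) g) :=
      (((hχc n).fderiv_apply (𝕜 := ℝ) 1).mul_right).sub
        (((hχc n).fderiv_apply (𝕜 := ℝ) I).mul_right)
    have i1 : Integrable fun z => χ n z * (p z * jac f g z) :=
      Continuous.integrable_of_hasCompactSupport (by fun_prop) (hχc n).mul_right
    have i2 : Integrable fun z => χ n z * (f z * jac p g z) :=
      Continuous.integrable_of_hasCompactSupport (by fun_prop) (hχc n).mul_right
    have i3 : Integrable fun z => p z * f z * jac (χ n) g z :=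
      Continuous.integrable_of_hasCompactSupport (by fun_prop) hsupp.mul_left
    have h := integral_jac_eq_zero ((hχ n).mul (hp.mul hf)) hg
      ((hχc n).mul_right (f' := fun z => p z * f z))
    have he : ∀ z, jac (fun y => χ n y * (p y * f y)) g z =
        χ n z * (p z * jac f g z) + χ n z * (f z * jac p g z) + p z * f z * jac (χ n) g z := by
      intro z
      have dp := hp.differentiable one_ne_zero z
      have df := hf.differentiable one_ne_zero z
      rw [jac_mul_left ((hχ n).differentiable one_ne_zero z) (dp.fun_mul df), jac_mul_left dp df]
      ring
    simp only [he] at h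
    rw [integral_add (by exact i1.add i2) i3, integral_add i1 i2] at h
    linarith
  simp only [hzero] at hA
  have := tendsto_nhds_unique hA (hB.neg.sub hC)
  simpa using this

lemma fderiv_apply_eq (u : ℂ → ℂ) (z v : ℂ) :
    fderiv ℝ u z v = dz u z * v + dzbar u z * (starRingEnd ℂ) v := by
  have h : fderiv ℝ u z v = v.re * fderiv ℝ u z 1 + v.im * fderiv ℝ u z I := by
    conv_lhs => rw [← re_add_im v]
    rw [show (v.re : ℂ) + v.im * I = v.re • (1 : ℂ) + v.im • I by simp, map_add, map_smul, map_smul,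
      real_smul, real_smul]
  rw [h, dz, dzbar]
  conv_rhs => rw [← re_add_im v]
  simp only [map_add, map_mul, conj_ofReal, conj_I]
  linear_combination ((v.im : ℂ) * fderiv ℝ u z I) * I_sq

lemma norm_fderiv_le {u : ℂ → ℂ} {z : ℂ} {B : ℝ} (h1 : ‖dz u z‖ ≤ B) (h2 : ‖dzbar u z‖ ≤ B) :
    ‖fderiv ℝ u z‖ ≤ 2 * B := by
  have hB : 0 ≤ B := (norm_nonneg _).trans h1
  refine ContinuousLinearMap.opNorm_le_bound _ (by positivity) fun v => ?_
  rw [fderiv_apply_eq]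
  calc ‖dz u z * v + dzbar u z * (starRingEnd ℂ) v‖
      ≤ ‖dz u z * v‖ + ‖dzbar u z * (starRingEnd ℂ) v‖ := norm_add_le _ _
    _ = ‖dz u z‖ * ‖v‖ + ‖dzbar u z‖ * ‖v‖ := by rw [norm_mul, norm_mul, RCLike.norm_conj]
    _ ≤ B * ‖v‖ + B * ‖v‖ := by gcongr
    _ = 2 * B * ‖v‖ := by ring

/-- For real functions with the decay of `u - c`, products have directional derivatives of
vanishing integral. -/
lemma integral_fderiv_mul_eq_zero {f g : ℂ → ℝ} (hf : ContDiff ℝ 1 f) (hg : ContDiff ℝ 1 g)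
    {K : ℝ} (hf0 : ∀ z, |f z| ≤ K / jb z) (hg0 : ∀ z, |g z| ≤ K / jb z)
    (hf1 : ∀ z, ‖fderiv ℝ f z‖ ≤ K / jb z ^ 2) (hg1 : ∀ z, ‖fderiv ℝ g z‖ ≤ K / jb z ^ 2)
    (v : ℂ) : ∫ z, (f z * fderiv ℝ g z v + g z * fderiv ℝ f z v) = 0 := by
  have hK : 0 ≤ K := by
    have := (abs_nonneg _).trans (hf0 0)
    simpa [jb] using this
  have hD : ∀ z, fderiv ℝ (fun y => f y * g y) z = f z • fderiv ℝ g z + g z • fderiv ℝ f z :=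
    fun z => fderiv_fun_mul (hf.differentiable one_ne_zero z) (hg.differentiable one_ne_zero z)
  have h := integral_fderiv_eq_zero_of_decay (hf.mul hg) (K := 2 * K ^ 2)
    (fun z => ?_) (fun z => ?_) v
  · simpa [hD] using h
  · have hj := jb_pos z
    rw [abs_mul]
    calc |f z| * |g z| ≤ (K / jb z) * (K / jb z) := by
          gcongr
          · exact hf0 z
          · exact hg0 z
      _ = K ^ 2 / jb z ^ 2 := by field_simp
      _ ≤ 2 * K ^ 2 / jb z ^ 2 := by gcongr; nlinarith [sq_nonneg K]
  · have hj := jb_pos z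
    rw [hD]
    calc ‖f z • fderiv ℝ g z + g z • fderiv ℝ f z‖
        ≤ |f z| * ‖fderiv ℝ g z‖ + |g z| * ‖fderiv ℝ f z‖ := by
          refine (norm_add_le _ _).trans_eq ?_
          rw [norm_smul, norm_smul, Real.norm_eq_abs, Real.norm_eq_abs]
      _ ≤ (K / jb z) * (K / jb z ^ 2) + (K / jb z) * (K / jb z ^ 2) := by
          gcongr
          · exact hf0 z
          · exact hg1 z
          · exact hg0 z
          · exact hf1 z
      _ = 2 * K ^ 2 / jb z ^ 3 := by field_simp; ring

/-- The moments of order at most one of the Jacobian determinant of a decaying divergence free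
vector field vanish. -/
lemma moments_jac {f g : ℂ → ℝ} (hf : ContDiff ℝ 1 f) (hg : ContDiff ℝ 1 g)
    {K : ℝ} (hf0 : ∀ z, |f z| ≤ K / jb z) (hg0 : ∀ z, |g z| ≤ K / jb z)
    (hf1 : ∀ z, ‖fderiv ℝ f z‖ ≤ K / jb z ^ 2) (hg1 : ∀ z, ‖fderiv ℝ g z‖ ≤ K / jb z ^ 2)
    (hdiv : ∀ z, fderiv ℝ f z 1 + fderiv ℝ g z I = 0) :
    ∫ z, jac f g z = 0 ∧ ∫ z : ℂ, z.re * jac f g z = 0 ∧ ∫ z : ℂ, z.im * jac f g z = 0 := by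
  have hK : 0 ≤ K := by
    have := (abs_nonneg _).trans (hf0 0)
    simpa [jb] using this
  have hre : ∀ z, fderiv ℝ re z = reCLM := fun z => reCLM.fderiv
  have him : ∀ z, fderiv ℝ im z = imCLM := fun z => imCLM.fderiv
  refine ⟨?_, ?_, ?_⟩
  · have h := integral_mul_jac (p := fun _ => 1) contDiff_const hf hg
      (fun z => by simpa using one_le_jb z) (fun z => by simp) hf0 hf1 hg1
    simpa [jac] using h
  · have h := integral_mul_jac (p := re) reCLM.contDiff hf hg
      (fun z => (abs_re_le_norm z).trans (norm_le_jb z))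
      (fun z => by rw [hre, reCLM_norm]) hf0 hf1 hg1
    have h2 := integral_fderiv_mul_eq_zero hf hf hf0 hf0 hf1 hf1 1
    rw [h, ← integral_neg]
    have he : ∀ z, -(f z * jac re g z) = 2⁻¹ * (f z * fderiv ℝ f z 1 + f z * fderiv ℝ f z 1) := by
      intro z
      simp only [jac, hre, reCLM_apply, one_re, I_re]
      linear_combination (-f z) * hdiv z
    simp only [he]
    rw [integral_const_mul, h2, mul_zero]
  · have h := integral_mul_jac (p := im) imCLM.contDiff hf hg
      (fun z => (abs_im_le_norm z).trans (norm_le_jb z))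
      (fun z => by rw [him, imCLM_norm]) hf0 hf1 hg1
    have hDf := hf.continuous_fderiv one_ne_zero
    have hDg := hg.continuous_fderiv one_ne_zero
    have hint : ∀ {a b : ℂ → ℝ}, ContDiff ℝ 1 a → ContDiff ℝ 1 b → (∀ z, |a z| ≤ K / jb z) →
        (∀ z, ‖fderiv ℝ b z‖ ≤ K / jb z ^ 2) → ∀ v : ℂ,
        Integrable fun z => a z * fderiv ℝ b z v := by
      intro a b ha hb ha0 hb1 v
      have hca := ha.continuous
      have hDb := hb.continuous_fderiv one_ne_zero
      refine integrable_of_le_jb (K := K ^ 2 * ‖v‖) (by fun_prop) fun z => ?_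
      have hj := jb_pos z
      rw [norm_mul]
      calc ‖a z‖ * ‖fderiv ℝ b z v‖ ≤ (K / jb z) * (K / jb z ^ 2 * ‖v‖) := by
            gcongr
            · exact ha0 z
            · exact (fderiv ℝ b z).le_of_opNorm_le (hb1 z) v
        _ = _ := by field_simp
    have h2 := integral_fderiv_mul_eq_zero hf hg hf0 hg0 hf1 hg1 1
    have h3 := integral_fderiv_mul_eq_zero hg hg hg0 hg0 hg1 hg1 I
    rw [h, ← integral_neg]
    have he : ∀ z, -(f z * jac im g z) = (f z * fderiv ℝ g z 1 + g z * fderiv ℝ f z 1)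
        + 2⁻¹ * (g z * fderiv ℝ g z I + g z * fderiv ℝ g z I) := by
      intro z
      simp only [jac, him, imCLM_apply, one_im, I_im]
      linear_combination (-g z) * hdiv z
    simp only [he]
    rw [integral_add, integral_const_mul, h2, h3, mul_zero, add_zero]
    · exact (hint hf hg hf0 hg1 1).add (hint hg hf hg0 hf1 1)
    · exact ((hint hg hg hg0 hg1 I).add (hint hg hg hg0 hg1 I)).const_mul _

/-- **vanishing moments of `Q(u)`.** If `u` is `C¹`, divergence free
(`Re ∂_z u = 0`), and `u - c`, `∂_z u`, `∂_z̄ u` decay like `⟨z⟩⁻¹`, `⟨z⟩⁻²`, `⟨z⟩⁻²`,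
then `Q(u) = (∂_z u)² + |∂_z̄ u|²` and `z̄ Q(u)` are integrable with vanishing integrals. -/
theorem Q_vanishing_moments (u : ℂ → ℂ) (hu : ContDiff ℝ 1 u)
    (hdiv : ∀ z : ℂ, (dz u z).re = 0)
    (c : ℂ) (C : ℝ) (hC : 0 < C)
    (hdecay0 : ∀ z : ℂ, ‖u z - c‖ ≤ C / jb z)
    (hdecay1 : ∀ z : ℂ, ‖dz u z‖ ≤ C / jb z ^ 2)
    (hdecay2 : ∀ z : ℂ, ‖dzbar u z‖ ≤ C / jb z ^ 2) :
    Integrable (fun z : ℂ => (dz u z) ^ 2 + ((‖dzbar u z‖ : ℂ)) ^ 2) volume ∧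
    Integrable (fun z : ℂ =>
      (starRingEnd ℂ) z * ((dz u z) ^ 2 + ((‖dzbar u z‖ : ℂ)) ^ 2)) volume ∧
    (∫ z : ℂ, (dz u z) ^ 2 + ((‖dzbar u z‖ : ℂ)) ^ 2) = 0 ∧
    (∫ z : ℂ, (starRingEnd ℂ) z * ((dz u z) ^ 2 + ((‖dzbar u z‖ : ℂ)) ^ 2)) = 0 := by
  set f : ℂ → ℝ := fun z => (u z - c).re
  set g : ℂ → ℝ := fun z => (u z - c).im
  have huc : ContDiff ℝ 1 fun z => u z - c := hu.sub contDiff_const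
  have hf : ContDiff ℝ 1 f := reCLM.contDiff.comp huc
  have hg : ContDiff ℝ 1 g := imCLM.contDiff.comp huc
  have hd : ∀ z, HasFDerivAt (fun y => u y - c) (fderiv ℝ u z) z := fun z =>
    (hu.differentiable one_ne_zero z).hasFDerivAt.sub_const c
  have hDf : ∀ z, fderiv ℝ f z = reCLM.comp (fderiv ℝ u z) := fun z =>
    (reCLM.hasFDerivAt.comp z (hd z)).fderiv
  have hDg : ∀ z, fderiv ℝ g z = imCLM.comp (fderiv ℝ u z) := fun z =>
    (imCLM.hasFDerivAt.comp z (hd z)).fderiv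
  have hDu : ∀ z, ‖fderiv ℝ u z‖ ≤ 2 * C / jb z ^ 2 := fun z =>
    (norm_fderiv_le (hdecay1 z) (hdecay2 z)).trans_eq (by ring)
  have h0 : ∀ z, ‖u z - c‖ ≤ 2 * C / jb z := fun z =>
    (hdecay0 z).trans (div_le_div_of_nonneg_right (by linarith) (jb_pos z).le)
  have hf0 : ∀ z, |f z| ≤ 2 * C / jb z := fun z => (abs_re_le_norm _).trans (h0 z)
  have hg0 : ∀ z, |g z| ≤ 2 * C / jb z := fun z => (abs_im_le_norm _).trans (h0 z)
  have hf1 : ∀ z, ‖fderiv ℝ f z‖ ≤ 2 * C / jb z ^ 2 := fun z => by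
    rw [hDf]
    refine (ContinuousLinearMap.opNorm_comp_le _ _).trans ?_
    rw [reCLM_norm, one_mul]
    exact hDu z
  have hg1 : ∀ z, ‖fderiv ℝ g z‖ ≤ 2 * C / jb z ^ 2 := fun z => by
    rw [hDg]
    refine (ContinuousLinearMap.opNorm_comp_le _ _).trans ?_
    rw [imCLM_norm, one_mul]
    exact hDu z
  have hdiv' : ∀ z, fderiv ℝ f z 1 + fderiv ℝ g z I = 0 := by
    intro z
    have := hdiv z
    simp [dz] at this
    simp [hDf, hDg]
    linarith
  have hQ : ∀ z, dz u z ^ 2 + (‖dzbar u z‖ : ℂ) ^ 2 = ((-jac f g z : ℝ) : ℂ) := by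
    intro z
    have h := hdiv' z
    rw [← ofReal_pow, ← normSq_eq_norm_sq, normSq_apply, jac]
    simp only [hDf, hDg, dz, dzbar, ContinuousLinearMap.comp_apply, reCLM_apply, imCLM_apply]
      at h ⊢
    generalize fderiv ℝ u z 1 = a at *
    generalize fderiv ℝ u z I = b at *
    have hb : b.im = -a.re := by linarith
    apply Complex.ext
    · simp [pow_two, hb]
      ring
    · simp [pow_two, hb]
  have cJ := continuous_jac hf hg
  have hJ : ∀ z, |jac f g z| ≤ 8 * C ^ 2 / jb z ^ 4 := fun z => by
    have hj := jb_pos z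
    calc |jac f g z| ≤ 2 * ((2 * C / jb z ^ 2) * (2 * C / jb z ^ 2)) := by
          refine (abs_jac_le f g z).trans ?_
          gcongr
          · exact hf1 z
          · exact hg1 z
      _ = _ := by field_simp; ring
  have hweight : ∀ p : ℂ → ℝ, Continuous p → (∀ z, |p z| ≤ jb z) →
      Integrable fun z => p z * jac f g z := by
    intro p hp hp0
    refine integrable_of_le_jb (K := 8 * C ^ 2) (by fun_prop) fun z => ?_
    have hj := jb_pos z
    rw [norm_mul]
    calc ‖p z‖ * ‖jac f g z‖ ≤ jb z * (8 * C ^ 2 / jb z ^ 4) := by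
          gcongr
          · exact hp0 z
          · exact hJ z
      _ = _ := by field_simp
  have i0 : Integrable (jac f g) := by
    simpa using hweight (fun _ => 1) continuous_const fun z => by simpa using one_le_jb z
  have i1 := hweight re continuous_re fun z => (abs_re_le_norm z).trans (norm_le_jb z)
  have i2 := hweight im continuous_im fun z => (abs_im_le_norm z).trans (norm_le_jb z)
  have hzQ : ∀ z : ℂ, (starRingEnd ℂ) z * ((-jac f g z : ℝ) : ℂ)
      = ((-(z.re * jac f g z) : ℝ) : ℂ) + ((z.im * jac f g z : ℝ) : ℂ) * I := by
    intro z
    apply Complex.ext <;> simp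
  have j1 : Integrable fun z : ℂ => ((-(z.re * jac f g z) : ℝ) : ℂ) := i1.neg.ofReal
  have j2 : Integrable fun z : ℂ => ((z.im * jac f g z : ℝ) : ℂ) * I := i2.ofReal.mul_const I
  obtain ⟨m0, m1, m2⟩ := moments_jac hf hg hf0 hg0 hf1 hg1 hdiv'
  simp only [hQ, hzQ]
  refine ⟨i0.neg.ofReal, j1.add j2, ?_, ?_⟩
  · rw [integral_complex_ofReal, integral_neg, m0, neg_zero, ofReal_zero]
  · rw [integral_add j1 j2, integral_mul_const, integral_complex_ofReal, integral_complex_ofReal,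
      integral_neg, m1, m2]
    simp

end
end

section
/- For every ε > 0 and every integer k ≥ 3 there exists a C^∞ function u₀ : ℂ → ℂ, with support contained in the annulus {z ∈ ℂ : ε ≤ |z| ≤ 2ε}, which is divergence free, i.e. Re(∂_z u₀) = 0 everywhere, and such that ∫_{ℝ²} conj(u₀(z))² · z̄^{k−3} dx dy ≠ 0. -/
open MeasureTheory Complex Filter
open scoped ENNReal

noncomputable section

/-- The rotated gradient `∂_y g - i ∂_x g` of a stream function `g`. -/
def rotGrad (g : ℂ → ℝ) (z : ℂ) : ℂ :=
  (fderiv ℝ g z I : ℂ) - I * (fderiv ℝ g z 1 : ℂ)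

/-- The conjugate `∂_y g + i ∂_x g = 2 i ∂_z g` of the rotated gradient. -/
def conjRotGrad (g : ℂ → ℝ) (z : ℂ) : ℂ :=
  (fderiv ℝ g z I : ℂ) + I * (fderiv ℝ g z 1 : ℂ)

lemma conj_rotGrad (g : ℂ → ℝ) (z : ℂ) :
    (starRingEnd ℂ) (rotGrad g z) = conjRotGrad g z := by
  simp [rotGrad, conjRotGrad]

lemma contDiff_fderiv_const {g : ℂ → ℝ} (hg : ContDiff ℝ (⊤ : ℕ∞) g) (v : ℂ) :
    ContDiff ℝ (⊤ : ℕ∞) fun z => fderiv ℝ g z v :=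
  (hg.fderiv_right (m := (⊤ : ℕ∞)) (by simp)).clm_apply contDiff_const

lemma contDiff_rotGrad {g : ℂ → ℝ} (hg : ContDiff ℝ (⊤ : ℕ∞) g) :
    ContDiff ℝ (⊤ : ℕ∞) (rotGrad g) :=
  (ofRealCLM.contDiff.comp (contDiff_fderiv_const hg I)).sub
    (contDiff_const.mul (ofRealCLM.contDiff.comp (contDiff_fderiv_const hg 1)))

lemma continuous_conjRotGrad {g : ℂ → ℝ} (hg : ContDiff ℝ (⊤ : ℕ∞) g) :
    Continuous (conjRotGrad g) := by
  have h := continuous_conj.comp (contDiff_rotGrad hg).continuous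
  exact h.congr fun z => conj_rotGrad g z

lemma fderiv_eq_zero_of_notMem_tsupport {g : ℂ → ℝ} {z : ℂ} (hz : z ∉ tsupport g) :
    fderiv ℝ g z = 0 :=
  image_eq_zero_of_notMem_tsupport fun h => hz (tsupport_fderiv_subset ℝ h)

lemma tsupport_rotGrad_subset (g : ℂ → ℝ) : tsupport (rotGrad g) ⊆ tsupport g := by
  refine closure_minimal (fun z hz => ?_) (isClosed_tsupport g)
  by_contra h
  exact hz (by simp [rotGrad, fderiv_eq_zero_of_notMem_tsupport h])

lemma re_dz_rotGrad {g : ℂ → ℝ} (hg : ContDiff ℝ (⊤ : ℕ∞) g) (z : ℂ) :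
    (dz (rotGrad g) z).re = 0 := by
  have hd : DifferentiableAt ℝ (fderiv ℝ g) z :=
    (hg.fderiv_right (m := (⊤ : ℕ∞)) (by simp)).differentiable (by simp) z
  have hv (v : ℂ) : HasFDerivAt (fun w => (fderiv ℝ g w v : ℂ))
      (ofRealCLM.comp ((fderiv ℝ (fderiv ℝ g) z).flip v)) z := by
    have h := hd.hasFDerivAt.clm_apply (hasFDerivAt_const v z)
    refine (ofRealCLM.hasFDerivAt.comp z h).congr_fderiv ?_
    ext w
    simp
  have h : HasFDerivAt (rotGrad g) _ z := (hv I).sub ((hv 1).const_mul I)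
  have hs : fderiv ℝ (fderiv ℝ g) z 1 I = fderiv ℝ (fderiv ℝ g) z I 1 :=
    (hg.contDiffAt.isSymmSndFDerivAt (by
      rw [minSmoothness_of_isRCLikeNormedField]
      exact WithTop.coe_le_coe.mpr (le_top : (2 : ℕ∞) ≤ ⊤))).eq 1 I
  simp [dz, h.fderiv, hs]

lemma conjRotGrad_add {f g : ℂ → ℝ} (hf : ContDiff ℝ (⊤ : ℕ∞) f) (hg : ContDiff ℝ (⊤ : ℕ∞) g)
    (z : ℂ) : conjRotGrad (f + g) z = conjRotGrad f z + conjRotGrad g z := by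
  have := fderiv_add (hf.differentiable (by simp) z) (hg.differentiable (by simp) z)
  simp only [conjRotGrad, this, add_apply, ofReal_add]
  ring

/-- The moment form `∫ (2 i ∂_z f) (2 i ∂_z g) z̄^m`. -/
def momentForm (m : ℕ) (f g : ℂ → ℝ) : ℂ :=
  ∫ z : ℂ, conjRotGrad f z * conjRotGrad g z * ((starRingEnd ℂ) z) ^ m

lemma integrable_momentForm (m : ℕ) {f g : ℂ → ℝ} (hf : ContDiff ℝ (⊤ : ℕ∞) f)
    (hg : ContDiff ℝ (⊤ : ℕ∞) g) (hfc : HasCompactSupport f) :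
    Integrable fun z : ℂ => conjRotGrad f z * conjRotGrad g z * ((starRingEnd ℂ) z) ^ m := by
  refine Continuous.integrable_of_hasCompactSupport
    (((continuous_conjRotGrad hf).mul (continuous_conjRotGrad hg)).mul
      (continuous_conj.pow m)) ?_
  refine HasCompactSupport.intro hfc fun z hz => ?_
  simp [conjRotGrad, fderiv_eq_zero_of_notMem_tsupport hz]

lemma momentForm_add_self (m : ℕ) {f g : ℂ → ℝ} (hf : ContDiff ℝ (⊤ : ℕ∞) f)
    (hg : ContDiff ℝ (⊤ : ℕ∞) g) (hfc : HasCompactSupport f) (hgc : HasCompactSupport g) :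
    momentForm m (f + g) (f + g) =
      momentForm m f f + momentForm m g g + 2 * momentForm m f g := by
  have h₁ := integrable_momentForm m hf hf hfc
  have h₂ := integrable_momentForm m hg hg hgc
  have h₃ := (integrable_momentForm m hf hg hfc).const_mul 2
  simp only [momentForm]
  rw [← integral_const_mul, ← integral_add h₁ h₂, ← integral_add (by exact h₁.add h₂) h₃]
  refine integral_congr_ae (Eventually.of_forall fun z => ?_)
  simp only [conjRotGrad_add hf hg]
  ring

lemma conjRotGrad_re_add_I_mul_im {f : ℂ → ℂ} {z : ℂ} (hf : DifferentiableAt ℝ f z) :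
    conjRotGrad (fun w => (f w).re) z + I * conjRotGrad (fun w => (f w).im) z =
      fderiv ℝ f z I + I * fderiv ℝ f z 1 := by
  have hr : HasFDerivAt (fun w => (f w).re) (reCLM.comp (fderiv ℝ f z)) z :=
    reCLM.hasFDerivAt.comp z hf.hasFDerivAt
  have hi : HasFDerivAt (fun w => (f w).im) (imCLM.comp (fderiv ℝ f z)) z :=
    imCLM.hasFDerivAt.comp z hf.hasFDerivAt
  simp only [conjRotGrad, hr.fderiv, hi.fderiv]
  apply Complex.ext
  · simp
  · simp
    ring

/-- Antiholomorphic factors are constants for `∂_z`. -/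
lemma conjRotGrad_mul_antiholomorphic {φ : ℂ → ℝ} {k : ℂ → ℂ} {z : ℂ}
    (hφ : DifferentiableAt ℝ φ z) (hk : DifferentiableAt ℂ k ((starRingEnd ℂ) z)) :
    conjRotGrad (fun w => ((φ w : ℂ) * k ((starRingEnd ℂ) w)).re) z +
      I * conjRotGrad (fun w => ((φ w : ℂ) * k ((starRingEnd ℂ) w)).im) z =
      conjRotGrad φ z * k ((starRingEnd ℂ) z) := by
  have h₁ : HasFDerivAt (fun w => (φ w : ℂ)) (ofRealCLM.comp (fderiv ℝ φ z)) z :=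
    ofRealCLM.hasFDerivAt.comp z hφ.hasFDerivAt
  have h₂ : HasFDerivAt (fun w => k ((starRingEnd ℂ) w)) _ z :=
    (hk.hasDerivAt.hasFDerivAt.restrictScalars ℝ).comp z
      (conjCLE : ℂ →L[ℝ] ℂ).hasFDerivAt
  have h : HasFDerivAt (fun w => (φ w : ℂ) * k ((starRingEnd ℂ) w)) _ z := h₁.mul h₂
  rw [conjRotGrad_re_add_I_mul_im h.differentiableAt, h.fderiv]
  simp [conjRotGrad]
  ring

/-- A radial bump function supported in the annulus `ε ≤ |z| ≤ 2ε`. -/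
lemma exists_radial_bump {ε : ℝ} (hε : 0 < ε) :
    ∃ φ : ℂ → ℝ, ContDiff ℝ (⊤ : ℕ∞) φ ∧
      tsupport φ ⊆ {z : ℂ | ε ≤ ‖z‖ ∧ ‖z‖ ≤ 2 * ε} ∧ (∃ z, fderiv ℝ φ z ≠ 0) ∧
      ∀ z, ∃ c : ℝ, conjRotGrad φ z = c * (I * (starRingEnd ℂ) z) := by
  let F : ContDiffBump (5 / 2 * ε ^ 2) :=
    ⟨ε ^ 2, 3 / 2 * ε ^ 2, by positivity, by nlinarith [pow_pos hε 2]⟩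
  have hF : ContDiff ℝ (⊤ : ℕ∞) F := F.contDiff
  have hφ : ContDiff ℝ (⊤ : ℕ∞) fun z : ℂ => F (‖z‖ ^ 2) := hF.comp (contDiff_norm_sq ℝ)
  have hsupp : tsupport (fun z : ℂ => F (‖z‖ ^ 2)) ⊆ {z : ℂ | ε ≤ ‖z‖ ∧ ‖z‖ ≤ 2 * ε} := by
    refine closure_minimal (fun z hz => ?_)
      ((isClosed_le continuous_const continuous_norm).inter
        (isClosed_le continuous_norm continuous_const))
    have hz' : ‖z‖ ^ 2 ∈ Function.support F := hz
    rw [F.support_eq, Metric.mem_ball, Real.dist_eq, abs_lt] at hz'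
    have h₁ : -(3 / 2 * ε ^ 2) < ‖z‖ ^ 2 - 5 / 2 * ε ^ 2 := hz'.1
    have h₂ : ‖z‖ ^ 2 - 5 / 2 * ε ^ 2 < 3 / 2 * ε ^ 2 := hz'.2
    have := norm_nonneg z
    exact ⟨by nlinarith, by nlinarith⟩
  refine ⟨fun z => F (‖z‖ ^ 2), hφ, hsupp, ?_, fun z => ⟨2 * deriv F (‖z‖ ^ 2), ?_⟩⟩
  · by_contra! h
    have hc := is_const_of_fderiv_eq_zero (hφ.differentiable (by simp)) h 0
      (Real.sqrt (5 / 2 * ε ^ 2) : ℂ)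
    have h0 : F (‖(0 : ℂ)‖ ^ 2) = 0 := by
      refine image_eq_zero_of_notMem_tsupport (f := fun z : ℂ => F (‖z‖ ^ 2)) fun h => ?_
      have := (hsupp h).1
      rw [norm_zero] at this
      linarith
    have h1 : F (‖(Real.sqrt (5 / 2 * ε ^ 2) : ℂ)‖ ^ 2) = 1 := by
      rw [norm_real, Real.norm_eq_abs, sq_abs, Real.sq_sqrt (by positivity)]
      exact F.one_of_mem_closedBall (Metric.mem_closedBall_self F.rIn_pos.le)
    simp only [h0, h1] at hc
    exact zero_ne_one hc
  · have hd := (hF.differentiable (by simp) (‖z‖ ^ 2)).hasDerivAt.comp_hasFDerivAt z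
      (hasStrictFDerivAt_norm_sq z).hasFDerivAt
    have hd' : fderiv ℝ (fun z : ℂ => F (‖z‖ ^ 2)) z = _ := hd.fderiv
    simp only [conjRotGrad, hd']
    apply Complex.ext <;> simp [Complex.inner] <;> ring

lemma isCompact_annulus (a b : ℝ) : IsCompact {z : ℂ | a ≤ ‖z‖ ∧ ‖z‖ ≤ b} := by
  refine (isCompact_closedBall (0 : ℂ) b).of_isClosed_subset
    ((isClosed_le continuous_const continuous_norm).inter
      (isClosed_le continuous_norm continuous_const)) fun z hz => ?_
  simpa using hz.2

/-- The moment form does not vanish on the diagonal of smooth functions on the annulus. -/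
lemma exists_momentForm_self_ne_zero {ε : ℝ} (hε : 0 < ε) (m : ℕ) :
    ∃ g : ℂ → ℝ, ContDiff ℝ (⊤ : ℕ∞) g ∧
      tsupport g ⊆ {z : ℂ | ε ≤ ‖z‖ ∧ ‖z‖ ≤ 2 * ε} ∧ momentForm m g g ≠ 0 := by
  by_contra! H
  obtain ⟨φ, hφ, hφs, ⟨z₀, hz₀⟩, hrad⟩ := exists_radial_bump hε
  have hcomp {g : ℂ → ℝ} (hg : tsupport g ⊆ {z : ℂ | ε ≤ ‖z‖ ∧ ‖z‖ ≤ 2 * ε}) :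
      HasCompactSupport g :=
    (isCompact_annulus ε (2 * ε)).of_isClosed_subset (isClosed_tsupport g) hg
  have hφ0 : (0 : ℂ) ∉ tsupport φ := fun h => by
    have := (hφs h).1
    rw [norm_zero] at this
    linarith
  have polar {g : ℂ → ℝ} (hg : ContDiff ℝ (⊤ : ℕ∞) g) (hgs : tsupport g ⊆ tsupport φ) :
      momentForm m φ g = 0 := by
    have h := momentForm_add_self m hφ hg (hcomp hφs) (hcomp (hgs.trans hφs))
    rw [H φ hφ hφs, H g hg (hgs.trans hφs), H (φ + g) (hφ.add hg)
      ((tsupport_add φ g).trans (Set.union_subset hφs (hgs.trans hφs)))] at h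
    simpa using h.symm
  let k : ℂ → ℂ := fun w => (w ^ (m + 2))⁻¹
  have hk {w : ℂ} (hw : w ≠ 0) : ContDiffAt ℂ (⊤ : ℕ∞) k w :=
    (contDiffAt_id.pow (m + 2)).inv (pow_ne_zero _ hw)
  let f : ℂ → ℂ := fun z => (φ z : ℂ) * k ((starRingEnd ℂ) z)
  have hf : ContDiff ℝ (⊤ : ℕ∞) f := by
    rw [contDiff_iff_contDiffAt]
    intro z
    by_cases hz : z ∈ tsupport φ
    · have hz0 : z ≠ 0 := fun h => hφ0 (h ▸ hz)
      exact (ofRealCLM.contDiff.comp hφ).contDiffAt.mul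
        (((hk (by simpa using hz0)).restrict_scalars ℝ).comp z
          (conjCLE : ℂ →L[ℝ] ℂ).contDiff.contDiffAt)
    · refine (contDiffAt_const (c := (0 : ℂ))).congr_of_eventuallyEq ?_
      filter_upwards [notMem_tsupport_iff_eventuallyEq.mp hz] with w hw
      simp [f, hw]
  have hre : ContDiff ℝ (⊤ : ℕ∞) fun z => (f z).re := reCLM.contDiff.comp hf
  have him : ContDiff ℝ (⊤ : ℕ∞) fun z => (f z).im := imCLM.contDiff.comp hf
  have hres : tsupport (fun z => (f z).re) ⊆ tsupport φ :=
    closure_mono fun z hz h => hz (by simp [f, h])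
  have hims : tsupport (fun z => (f z).im) ⊆ tsupport φ :=
    closure_mono fun z hz h => hz (by simp [f, h])
  have key (z : ℂ) : conjRotGrad φ z * conjRotGrad (fun z => (f z).re) z *
        ((starRingEnd ℂ) z) ^ m + I * (conjRotGrad φ z * conjRotGrad (fun z => (f z).im) z *
        ((starRingEnd ℂ) z) ^ m) =
      ((-(‖fderiv ℝ φ z I‖ ^ 2 + ‖fderiv ℝ φ z 1‖ ^ 2) / ‖z‖ ^ 2 : ℝ) : ℂ) := by
    by_cases hz : z ∈ tsupport φ
    · have hz0 : z ≠ 0 := fun h => hφ0 (h ▸ hz)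
      have hz0' : (starRingEnd ℂ) z ≠ 0 := by simpa using hz0
      have h := conjRotGrad_mul_antiholomorphic (hφ.differentiable (by simp) z)
        ((hk hz0').differentiableAt (by simp))
      obtain ⟨c, hc⟩ := hrad z
      have hnorm : ‖fderiv ℝ φ z I‖ ^ 2 + ‖fderiv ℝ φ z 1‖ ^ 2 = c ^ 2 * ‖z‖ ^ 2 := by
        have := congrArg normSq hc
        simp only [map_mul, normSq_ofReal, normSq_I, normSq_conj, ← Complex.sq_norm z] at this
        rw [Real.norm_eq_abs, Real.norm_eq_abs, sq_abs, sq_abs, sq, sq, sq c, ← one_mul (‖z‖ ^ 2),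
          ← this]
        simp [conjRotGrad, normSq_apply]
      have hzn : ‖z‖ ^ 2 ≠ 0 := by simpa using hz0
      rw [hnorm, neg_div, mul_div_assoc, div_self hzn]
      calc _ = conjRotGrad φ z * (conjRotGrad (fun z => (f z).re) z +
              I * conjRotGrad (fun z => (f z).im) z) * ((starRingEnd ℂ) z) ^ m := by ring
        _ = conjRotGrad φ z * (conjRotGrad φ z * k ((starRingEnd ℂ) z)) *
              ((starRingEnd ℂ) z) ^ m := by rw [h]
        _ = I ^ 2 * c ^ 2 := by
          rw [hc]
          simp only [k]
          field_simp
          ring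
        _ = _ := by simp
    · simp [conjRotGrad, fderiv_eq_zero_of_notMem_tsupport hz]
  have hI₁ := integrable_momentForm m hφ hre (hcomp hφs)
  have hI₂ := (integrable_momentForm m hφ him (hcomp hφs)).const_mul I
  have hsum := integral_add hI₁ hI₂
  have hfI := hI₁.add hI₂
  rw [integral_const_mul] at hsum
  have h₁ := polar hre hres
  have h₂ := polar him hims
  simp only [momentForm] at h₁ h₂
  rw [h₁, h₂, mul_zero, add_zero] at hsum
  simp only [key] at hsum
  have hrI : Integrable fun z =>
      ((-(‖fderiv ℝ φ z I‖ ^ 2 + ‖fderiv ℝ φ z 1‖ ^ 2) / ‖z‖ ^ 2 : ℝ) : ℂ) :=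
    hfI.congr (Eventually.of_forall key)
  rw [integral_complex_ofReal, ofReal_eq_zero, ← neg_eq_zero, ← integral_neg,
    integral_eq_zero_iff_of_nonneg (fun z => ?_) (by exact hrI.re.neg)] at hsum
  · have hzero : conjRotGrad φ =ᵐ[volume] fun _ => 0 := by
      filter_upwards [hsum] with z hz
      by_cases hz0 : z = 0
      · subst hz0
        simp [conjRotGrad, fderiv_eq_zero_of_notMem_tsupport hφ0]
      · have hzn : ‖z‖ ^ 2 ≠ 0 := by simpa using hz0
        have h : ‖fderiv ℝ φ z I‖ ^ 2 + ‖fderiv ℝ φ z 1‖ ^ 2 = 0 := by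
          simp only [neg_div, neg_neg, Pi.zero_apply, div_eq_zero_iff, hzn, or_false] at hz
          exact hz
        have hI : ‖fderiv ℝ φ z I‖ ^ 2 = 0 := by nlinarith [sq_nonneg ‖fderiv ℝ φ z 1‖]
        have h1 : ‖fderiv ℝ φ z 1‖ ^ 2 = 0 := by nlinarith
        simp only [sq_eq_zero_iff, norm_eq_zero] at hI h1
        simp [conjRotGrad, hI, h1]
    have hall := congrFun
      ((continuous_conjRotGrad hφ).ae_eq_iff_eq volume continuous_const |>.mp hzero) z₀
    refine hz₀ (ContinuousLinearMap.ext fun w => ?_)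
    have hI : fderiv ℝ φ z₀ I = 0 := by simpa [conjRotGrad] using congrArg re hall
    have h1 : fderiv ℝ φ z₀ 1 = 0 := by simpa [conjRotGrad] using congrArg im hall
    have hw : w = w.re • (1 : ℂ) + w.im • I := by simp
    rw [hw, map_add, map_smul, map_smul, hI, h1]
    simp
  · simp only [Pi.zero_apply, neg_div, neg_neg]
    positivity

/-- For every `ε > 0` and integer `k ≥ 3` there is a smooth divergence-free
(`Re ∂_z u₀ = 0`) function `u₀ : ℂ → ℂ` supported in the annulus `ε ≤ |z| ≤ 2ε` such that
`∫ conj(u₀)² z̄^{k-3} dx dy ≠ 0`. -/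
theorem exists_compactly_supported_nonvanishing_moment (ε : ℝ) (hε : 0 < ε) (k : ℕ)
    (hk : 3 ≤ k) :
    ∃ u₀ : ℂ → ℂ, ContDiff ℝ (⊤ : ℕ∞) u₀ ∧
      tsupport u₀ ⊆ {z : ℂ | ε ≤ ‖z‖ ∧ ‖z‖ ≤ 2 * ε} ∧
      (∀ z : ℂ, (dz u₀ z).re = 0) ∧
      (∫ z : ℂ, ((starRingEnd ℂ) (u₀ z)) ^ 2 * ((starRingEnd ℂ) z) ^ (k - 3)) ≠ 0 := by
  obtain ⟨g, hg, hgs, hne⟩ := exists_momentForm_self_ne_zero hε (k - 3)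
  refine ⟨rotGrad g, contDiff_rotGrad hg, (tsupport_rotGrad_subset g).trans hgs,
    re_dz_rotGrad hg, ?_⟩
  simpa only [conj_rotGrad, sq, momentForm] using hne

end
end
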